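/- Let N ≥ 3 be an integer, α ≥ 0, and p_α = (N+2+2α)/(N-2). For each p ∈ (1, p_α) let u_p ∈ C²([0,1]) be a positive radial solution: u_p > 0 on [0,1), u_p(1) = 0, u_p'(0) = 0, solving u_p''(r) + ((N-1)/r) u_p'(r) + r^{α} u_p(r)^{p} = 0 on (0,1). Then, as p → p_α⁻, μ_p := u_p(0) → +∞, and the rescaled functions ũ_p(r) = u_p(r / μ̃_p) / μ_p, with μ̃_p = μ_p^{(p-1)/(2+α)}, converge to U_α in C¹ locally on [0,∞): for every R > 0, ũ_p → U_α and ũ_p' → U_α' uniformly on [0, R]. -/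

import Mathlib

open Real Filter Set Topology

/-- A function that is antitone on `(0, T)` lies below its limit at `0⁺`. -/
lemma AntitoneOn.le_of_tendsto_nhdsGT_zero {f : ℝ → ℝ} {T l : ℝ} (hf : AntitoneOn f (Ioo 0 T))
    (hl : Tendsto f (𝓝[>] 0) (𝓝 l)) {r : ℝ} (hr : r ∈ Ioo 0 T) : f r ≤ l := by
  refine ge_of_tendsto hl ?_
  filter_upwards [Ioo_mem_nhdsGT hr.1] with s hs
  exact hf ⟨hs.1, hs.2.trans hr.2⟩ hr hs.2.le

/-- Antitonicity on an open interval from a pointwise nonpositive derivative. -/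
lemma antitoneOn_Ioo_of_hasDerivAt_nonpos {f f' : ℝ → ℝ} {a b : ℝ}
    (hf : ∀ r ∈ Ioo a b, HasDerivAt f (f' r) r) (hf' : ∀ r ∈ Ioo a b, f' r ≤ 0) :
    AntitoneOn f (Ioo a b) := by
  refine antitoneOn_of_deriv_nonpos (convex_Ioo a b)
    (fun r hr => (hf r hr).continuousAt.continuousWithinAt) ?_ ?_
  · intro r hr
    rw [interior_Ioo] at hr
    exact (hf r hr).differentiableAt.differentiableWithinAt
  · intro r hr
    rw [interior_Ioo] at hr
    rw [(hf r hr).deriv]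
    exact hf' r hr

/-- Grönwall estimate for the sum of the squares of a function and its derivative, needing only a
one-sided bound on the product of the first two derivatives. -/
lemma energy_gronwall {w w' w'' : ℝ → ℝ} {T K ε : ℝ} (hK : 0 ≤ K)
    (hw : ∀ r ∈ Ioo 0 T, HasDerivAt w (w' r) r)
    (hw' : ∀ r ∈ Ioo 0 T, HasDerivAt w' (w'' r) r)
    (hw0 : Tendsto w (𝓝[>] 0) (𝓝 0)) (hw'0 : Tendsto w' (𝓝[>] 0) (𝓝 0))
    (hb : ∀ r ∈ Ioo 0 T, w' r * w'' r ≤ |w' r| * (K * |w r| + ε)) {r : ℝ} (hr : r ∈ Ioo 0 T) :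
    w r ^ 2 + w' r ^ 2 ≤ ε ^ 2 * r * exp ((2 + K) * r) := by
  have hanti : AntitoneOn
      (fun s => (w s ^ 2 + w' s ^ 2) * exp (-((2 + K) * s)) - ε ^ 2 * s) (Ioo 0 T) := by
    refine antitoneOn_Ioo_of_hasDerivAt_nonpos (f' := fun s =>
      (2 * w s * w' s + 2 * w' s * w'' s - (2 + K) * (w s ^ 2 + w' s ^ 2)) *
        exp (-((2 + K) * s)) - ε ^ 2) ?_ ?_
    · intro s hs
      have h := ((((hw s hs).pow 2).add ((hw' s hs).pow 2)).mul
        (((hasDerivAt_id s).const_mul (2 + K)).neg.exp)).sub ((hasDerivAt_id s).const_mul (ε ^ 2))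
      refine h.congr_deriv ?_
      simp only [Pi.add_apply, Pi.pow_apply, id, Pi.neg_apply]
      push_cast
      ring
    · intro s hs
      have he1 : exp (-((2 + K) * s)) ≤ 1 := by
        rw [exp_le_one_iff]
        have := mul_nonneg (by linarith : (0 : ℝ) ≤ 2 + K) hs.1.le
        linarith
      have he0 := exp_pos (-((2 + K) * s))
      have hkey : 2 * w s * w' s + 2 * w' s * w'' s - (2 + K) * (w s ^ 2 + w' s ^ 2)
          ≤ ε ^ 2 := by
        have h1 := hb s hs
        have h2 : 2 * (|w' s| * |w s|) ≤ w s ^ 2 + w' s ^ 2 := by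
          nlinarith [sq_nonneg (|w' s| - |w s|), sq_abs (w s), sq_abs (w' s)]
        have h3 : 2 * (|w' s| * ε) ≤ w' s ^ 2 + ε ^ 2 := by
          nlinarith [sq_nonneg (|w' s| - ε), sq_abs (w' s)]
        nlinarith [sq_nonneg (w s - w' s), mul_le_mul_of_nonneg_left h2 hK, sq_nonneg (w s)]
      nlinarith [mul_le_mul_of_nonneg_right hkey he0.le, sq_nonneg ε]
  have hlim : Tendsto (fun s => (w s ^ 2 + w' s ^ 2) * exp (-((2 + K) * s)) - ε ^ 2 * s)
      (𝓝[>] 0) (𝓝 0) := by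
    have hc : Tendsto (fun s : ℝ => exp (-((2 + K) * s))) (𝓝[>] 0) (𝓝 (exp (-((2 + K) * 0)))) :=
      (Continuous.tendsto (by fun_prop) 0).mono_left nhdsWithin_le_nhds
    have hd : Tendsto (fun s : ℝ => ε ^ 2 * s) (𝓝[>] 0) (𝓝 (ε ^ 2 * 0)) :=
      (Continuous.tendsto (by fun_prop) 0).mono_left nhdsWithin_le_nhds
    simpa using (((hw0.pow 2).add (hw'0.pow 2)).mul hc).sub hd
  have h := hanti.le_of_tendsto_nhdsGT_zero hlim hr
  have hexp : exp (-((2 + K) * r)) * exp ((2 + K) * r) = 1 := by rw [← exp_add]; simp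
  have h' := mul_le_mul_of_nonneg_right (sub_nonpos.1 h) (exp_pos ((2 + K) * r)).le
  rwa [mul_assoc, hexp, mul_one] at h'

/-- On `[0, 1]` the power `x ^ p` is Lipschitz in the base and in the exponent. -/
lemma abs_rpow_sub_rpow_le {x y p q : ℝ} (hp : 1 ≤ p) (hpq : p ≤ q) (hx : x ∈ Icc (0 : ℝ) 1)
    (hy : y ∈ Ioc (0 : ℝ) 1) : |x ^ p - y ^ q| ≤ q * |x - y| + (q - p) := by
  have h1 : |x ^ p - y ^ p| ≤ p * |x - y| := by
    have h := Convex.norm_image_sub_le_of_norm_hasDerivWithin_le (f := fun t : ℝ => t ^ p)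
      (f' := fun t => p * t ^ (p - 1)) (s := Icc 0 1) (C := p) (x := y) (y := x)
      (fun t _ => (Real.hasDerivAt_rpow_const (Or.inr hp)).hasDerivWithinAt)
      (fun t ht => by
        rw [Real.norm_eq_abs, abs_of_nonneg (by have := rpow_nonneg ht.1 (p - 1); positivity)]
        exact mul_le_of_le_one_right (by linarith) (rpow_le_one ht.1 ht.2 (by linarith)))
      (convex_Icc 0 1) ⟨hy.1.le, hy.2⟩ hx
    simpa [Real.norm_eq_abs] using h
  have h2 : |y ^ p - y ^ q| ≤ q - p := by
    have hle : y ^ q ≤ y ^ p := rpow_le_rpow_of_exponent_ge hy.1 hy.2 hpq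
    rw [abs_of_nonneg (by linarith)]
    have hsplit : y ^ q = y ^ p * y ^ (q - p) := by rw [← rpow_add hy.1]; ring_nf
    have hyp : y ^ p ≤ y := by
      simpa using rpow_le_rpow_of_exponent_ge hy.1 hy.2 hp
    have hexp : 1 + log y * (q - p) ≤ y ^ (q - p) := by
      rw [rpow_def_of_pos hy.1]
      linarith [add_one_le_exp (log y * (q - p))]
    have hlog : -1 ≤ y * log y := by
      have h := one_sub_inv_le_log_of_pos hy.1
      have h' := mul_le_mul_of_nonneg_left h hy.1.le
      rw [mul_sub, mul_inv_cancel₀ hy.1.ne'] at h'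
      linarith [hy.1]
    have hlog0 : log y ≤ 0 := log_nonpos hy.1.le hy.2
    have hy0 : 0 ≤ y ^ p := rpow_nonneg hy.1.le p
    have hlog' : -1 ≤ y ^ p * log y := by nlinarith
    rw [hsplit]
    nlinarith [mul_le_mul_of_nonneg_left hexp hy0, sub_nonneg.2 hpq]
  calc |x ^ p - y ^ q| = |(x ^ p - y ^ p) + (y ^ p - y ^ q)| := by ring_nf
    _ ≤ |x ^ p - y ^ p| + |y ^ p - y ^ q| := abs_add_le _ _
    _ ≤ q * |x - y| + (q - p) := by
      have := mul_le_mul_of_nonneg_right hpq (abs_nonneg (x - y))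
      linarith

/-- The limit profile `U_α`, with the dimension as a real parameter `n`. -/
noncomputable def henonBubble (n α r : ℝ) : ℝ :=
  (1 + r ^ (2 + α) / ((n + α) * (n - 2))) ^ (-(n - 2) / (2 + α))

/-- The derivative of `henonBubble` on `(0, ∞)`. -/
noncomputable def henonBubbleDeriv (n α r : ℝ) : ℝ :=
  -(r ^ (1 + α) / (n + α)) *
    (1 + r ^ (2 + α) / ((n + α) * (n - 2))) ^ (-(n - 2) / (2 + α) - 1)

section Bubble

variable {n α r : ℝ}

lemma one_le_henonBubble_base (hn : 2 < n) (hα : 0 ≤ α) (hr : 0 ≤ r) :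
    1 ≤ 1 + r ^ (2 + α) / ((n + α) * (n - 2)) := by
  have h1 : 0 < n - 2 := by linarith
  have h2 : 0 < n + α := by linarith
  have := rpow_nonneg hr (2 + α)
  have : 0 ≤ r ^ (2 + α) / ((n + α) * (n - 2)) := by positivity
  linarith

lemma hasDerivAt_henonBubble_base (hα : 0 ≤ α) :
    HasDerivAt (fun r : ℝ => 1 + r ^ (2 + α) / ((n + α) * (n - 2)))
      ((2 + α) * r ^ (1 + α) / ((n + α) * (n - 2))) r := by
  have h := ((Real.hasDerivAt_rpow_const (x := r) (p := 2 + α)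
    (Or.inr (by linarith))).div_const ((n + α) * (n - 2))).const_add 1
  refine h.congr_deriv ?_
  rw [show 2 + α - 1 = 1 + α by ring]

lemma hasDerivAt_henonBubble (hn : 2 < n) (hα : 0 ≤ α) (hr : 0 ≤ r) :
    HasDerivAt (henonBubble n α) (henonBubbleDeriv n α r) r := by
  have hb := one_le_henonBubble_base hn hα hr
  have h := (hasDerivAt_henonBubble_base (n := n) (r := r) hα).rpow_const
    (p := -(n - 2) / (2 + α)) (Or.inl (by linarith))
  refine h.congr_deriv ?_
  have h1 : n - 2 ≠ 0 := by linarith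
  have h2 : n + α ≠ 0 := by linarith
  have h3 : 2 + α ≠ 0 := by linarith
  unfold henonBubbleDeriv
  field_simp

lemma hasDerivAt_henonBubbleDeriv (hn : 2 < n) (hα : 0 ≤ α) (hr : 0 < r) :
    HasDerivAt (henonBubbleDeriv n α)
      (-((n - 1) / r) * henonBubbleDeriv n α r -
        r ^ α * henonBubble n α r ^ ((n + 2 + 2 * α) / (n - 2))) r := by
  have hb := one_le_henonBubble_base hn hα hr.le
  have h1 : n - 2 ≠ 0 := by linarith
  have h2 : n + α ≠ 0 := by linarith
  have h3 : 2 + α ≠ 0 := by linarith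
  have h := (((Real.hasDerivAt_rpow_const (x := r) (p := 1 + α)
    (Or.inr (by linarith))).div_const (n + α)).neg).mul
    ((hasDerivAt_henonBubble_base (n := n) (r := r) hα).rpow_const
    (p := -(n - 2) / (2 + α) - 1) (Or.inl (by linarith)))
  refine h.congr_deriv ?_
  unfold henonBubbleDeriv henonBubble
  have hG : 1 + r ^ (2 + α) / ((n + α) * (n - 2)) = 1 + r ^ α * r ^ 2 / ((n + α) * (n - 2)) := by
    rw [add_comm 2 α, rpow_add hr, rpow_two]
  have hr1 : r ^ (1 + α) = r ^ α * r := by rw [add_comm 1 α, rpow_add hr, rpow_one]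
  have hr2 : r ^ (1 + α - 1) = r ^ α := by congr 1; ring
  rw [← rpow_mul (by linarith)]
  have hexp : -(n - 2) / (2 + α) * ((n + 2 + 2 * α) / (n - 2)) =
      -(n - 2) / (2 + α) - 1 - 1 := by
    field_simp
    ring
  rw [hexp, rpow_sub_one (by linarith) (-(n - 2) / (2 + α) - 1), hr2, hr1]
  have hG0 : 1 + r ^ α * r ^ 2 / ((n + α) * (n - 2)) ≠ 0 := by rw [← hG]; linarith
  simp only [Pi.neg_apply]
  rw [hr1, hG]
  generalize (1 + r ^ α * r ^ 2 / ((n + α) * (n - 2))) ^ (-(n - 2) / (2 + α) - 1) = P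
  have hG0' : (n + α) * (n - 2) + r ^ α * r ^ 2 ≠ 0 := by
    intro h0
    apply hG0
    field_simp
    linarith
  generalize r ^ α = A at *
  field_simp
  ring

lemma henonBubble_pos (hn : 2 < n) (hα : 0 ≤ α) (hr : 0 ≤ r) : 0 < henonBubble n α r :=
  rpow_pos_of_pos (by linarith [one_le_henonBubble_base hn hα hr]) _

lemma henonBubble_le_one (hn : 2 < n) (hα : 0 ≤ α) (hr : 0 ≤ r) : henonBubble n α r ≤ 1 :=
  rpow_le_one_of_one_le_of_nonpos (one_le_henonBubble_base hn hα hr)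
    (div_nonpos_of_nonpos_of_nonneg (by linarith) (by linarith))

lemma henonBubble_antitoneOn (hn : 2 < n) (hα : 0 ≤ α) :
    AntitoneOn (henonBubble n α) (Ici 0) := by
  intro r hr s _ hrs
  have h1 : 0 < n - 2 := by linarith
  have h2 : 0 < n + α := by linarith
  have hb := one_le_henonBubble_base hn hα hr
  have hpow : r ^ (2 + α) ≤ s ^ (2 + α) := rpow_le_rpow hr hrs (by linarith)
  refine rpow_le_rpow_of_nonpos (by linarith) ?_
    (div_nonpos_of_nonpos_of_nonneg (by linarith) (by linarith))
  gcongr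

lemma henonBubble_zero (hα : 0 ≤ α) : henonBubble n α 0 = 1 := by
  simp [henonBubble, zero_rpow (by linarith : 2 + α ≠ 0)]

lemma henonBubbleDeriv_zero (hα : 0 ≤ α) : henonBubbleDeriv n α 0 = 0 := by
  simp [henonBubbleDeriv, zero_rpow (by linarith : 1 + α ≠ 0)]

lemma tendsto_henonBubbleDeriv_zero (hα : 0 ≤ α) :
    Tendsto (henonBubbleDeriv n α) (𝓝[>] 0) (𝓝 0) := by
  have hc : ContinuousAt (henonBubbleDeriv n α) 0 := by
    have hpow : ContinuousAt (fun r : ℝ => r ^ (1 + α)) 0 :=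
      continuousAt_rpow_const _ _ (Or.inr (by linarith))
    refine ((hpow.div_const (n + α)).neg).mul
      ((hasDerivAt_henonBubble_base (n := n) hα).continuousAt.rpow_const (Or.inl ?_))
    simp [zero_rpow (by linarith : 2 + α ≠ 0)]
  have h := hc.tendsto
  rw [henonBubbleDeriv_zero hα] at h
  exact h.mono_left nhdsWithin_le_nhds

end Bubble

/-- Positive radial `C²` solutions of the Hénon equation on the unit ball. -/
structure IsHenonSolution (n α p : ℝ) (u : ℝ → ℝ) : Prop where
  contDiffOn : ContDiffOn ℝ 2 u (Icc 0 1)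
  pos : ∀ r ∈ Ico (0 : ℝ) 1, 0 < u r
  apply_one : u 1 = 0
  ode : ∀ r ∈ Ioo (0 : ℝ) 1,
    deriv (deriv u) r + ((n - 1) / r) * deriv u r + r ^ α * u r ^ p = 0

/-- The factor `μ̃` by which the variable of a solution is rescaled. -/
noncomputable def henonScale (α p : ℝ) (u : ℝ → ℝ) : ℝ := u 0 ^ ((p - 1) / (2 + α))

/-- The rescaled solution `ũ`. -/
noncomputable def henonRescale (α p : ℝ) (u : ℝ → ℝ) (r : ℝ) : ℝ :=
  u (r / henonScale α p u) / u 0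

lemma deriv_henonRescale (α p : ℝ) (u : ℝ → ℝ) (r : ℝ) :
    deriv (henonRescale α p u) r =
      deriv u (r / henonScale α p u) / (u 0 * henonScale α p u) := by
  have h : henonRescale α p u = fun r => u ((henonScale α p u)⁻¹ * r) / u 0 := by
    funext r
    rw [henonRescale, div_eq_inv_mul r]
  rw [h, deriv_div_const, deriv_comp_mul_left, div_eq_inv_mul r, smul_eq_mul]
  simp only [div_eq_mul_inv, mul_inv]
  ring

namespace IsHenonSolution

variable {n α p : ℝ} {u : ℝ → ℝ}

lemma hasDerivAt (h : IsHenonSolution n α p u) {r : ℝ} (hr : r ∈ Ioo (0 : ℝ) 1) :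
    HasDerivAt u (deriv u r) r :=
  ((h.contDiffOn.contDiffAt (Icc_mem_nhds hr.1 hr.2)).differentiableAt (by norm_num)).hasDerivAt

lemma contDiffOn_deriv (h : IsHenonSolution n α p u) :
    ContDiffOn ℝ 1 (deriv u) (Ioo (0 : ℝ) 1) :=
  ((contDiffOn_succ_iff_deriv_of_isOpen (n := 1) isOpen_Ioo).1
    (by simpa [one_add_one_eq_two] using h.contDiffOn.mono Ioo_subset_Icc_self)).2.2

lemma hasDerivAt_deriv (h : IsHenonSolution n α p u) {r : ℝ} (hr : r ∈ Ioo (0 : ℝ) 1) :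
    HasDerivAt (deriv u) (-((n - 1) / r) * deriv u r - r ^ α * u r ^ p) r := by
  have hd : DifferentiableAt ℝ (deriv u) r :=
    ((h.contDiffOn_deriv.contDiffAt (isOpen_Ioo.mem_nhds hr))).differentiableAt (by norm_num)
  exact hd.hasDerivAt.congr_deriv (by linarith [h.ode r hr])

lemma tendsto_zero (h : IsHenonSolution n α p u) : Tendsto u (𝓝[>] 0) (𝓝 (u 0)) :=
  ((h.contDiffOn.continuousOn 0 (by simp)).mono_of_mem_nhdsWithin
    (Icc_mem_nhdsGT (by norm_num))).tendsto

/-- The equation forces the derivative to vanish at the origin. -/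
lemma tendsto_deriv_zero (h : IsHenonSolution n α p u) (hn : 2 < n) (hα : 0 ≤ α) (hp : 1 < p) :
    Tendsto (deriv u) (𝓝[>] 0) (𝓝 0) := by
  have huniq : UniqueDiffOn ℝ (Icc (0 : ℝ) 1) := uniqueDiffOn_Icc (by norm_num)
  have hc : ContDiffOn ℝ 1 (derivWithin u (Icc 0 1)) (Icc 0 1) :=
    h.contDiffOn.derivWithin huniq (by norm_num [one_add_one_eq_two])
  have hcc : ContinuousOn (derivWithin (derivWithin u (Icc 0 1)) (Icc 0 1)) (Icc 0 1) :=
    hc.continuousOn_derivWithin huniq le_rfl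
  have hd : ∀ r ∈ Ioo (0 : ℝ) 1, derivWithin u (Icc 0 1) r = deriv u r := fun r hr =>
    derivWithin_of_mem_nhds (Icc_mem_nhds hr.1 hr.2)
  have hdd : ∀ r ∈ Ioo (0 : ℝ) 1,
      derivWithin (derivWithin u (Icc 0 1)) (Icc 0 1) r = deriv (deriv u) r := fun r hr => by
    rw [derivWithin_of_mem_nhds (Icc_mem_nhds hr.1 hr.2)]
    exact Filter.EventuallyEq.deriv_eq
      (by filter_upwards [isOpen_Ioo.mem_nhds hr] with s hs using hd s hs)
  have hlim := ((hcc 0 (by simp)).mono_of_mem_nhdsWithin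
    (Icc_mem_nhdsGT (by norm_num : (0 : ℝ) < 1))).tendsto
  have hid : Tendsto (fun r : ℝ => r) (𝓝[>] 0) (𝓝 0) := nhdsWithin_le_nhds
  have hpow : Tendsto (fun r : ℝ => r ^ α) (𝓝[>] 0) (𝓝 (0 ^ α)) :=
    (continuousAt_rpow_const 0 α (Or.inr hα)).tendsto.mono_left nhdsWithin_le_nhds
  have hup : Tendsto (fun r : ℝ => u r ^ p) (𝓝[>] 0) (𝓝 (u 0 ^ p)) :=
    h.tendsto_zero.rpow_const (Or.inr (by linarith))
  have hall := ((hid.div_const (n - 1)).neg).mul (hlim.add (hpow.mul hup))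
  simp only [zero_div, neg_zero, zero_mul] at hall
  refine hall.congr' ?_
  filter_upwards [Ioo_mem_nhdsGT (by norm_num : (0 : ℝ) < 1)] with r hr
  have hode := h.ode r hr
  have hr0 : r ≠ 0 := hr.1.ne'
  have hn1 : n - 1 ≠ 0 := by linarith
  rw [hdd r hr]
  have hsum : deriv (deriv u) r + r ^ α * u r ^ p = -((n - 1) / r * deriv u r) := by linarith
  rw [hsum]
  field_simp

lemma deriv_nonpos (h : IsHenonSolution n α p u) (hn : 2 < n) (hα : 0 ≤ α) (hp : 1 < p)
    {r : ℝ} (hr : r ∈ Ioo (0 : ℝ) 1) : deriv u r ≤ 0 := by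
  have hanti : AntitoneOn (fun s => s ^ (n - 1) * deriv u s) (Ioo 0 1) := by
    refine antitoneOn_Ioo_of_hasDerivAt_nonpos
      (f' := fun s => -(s ^ (n - 1) * (s ^ α * u s ^ p))) ?_ ?_
    · intro s hs
      refine ((Real.hasDerivAt_rpow_const (p := n - 1) (Or.inl hs.1.ne')).mul
        (h.hasDerivAt_deriv hs)).congr_deriv ?_
      rw [rpow_sub_one hs.1.ne' (n - 1)]
      have := hs.1.ne'
      field_simp
      ring
    · intro s hs
      have h1 := rpow_nonneg hs.1.le (n - 1)
      have h2 := rpow_nonneg hs.1.le α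
      have h3 := rpow_nonneg (h.pos s ⟨hs.1.le, hs.2⟩).le p
      have : 0 ≤ s ^ (n - 1) * (s ^ α * u s ^ p) := by positivity
      linarith
  have hlim : Tendsto (fun s => s ^ (n - 1) * deriv u s) (𝓝[>] 0) (𝓝 0) := by
    have hpow : Tendsto (fun r : ℝ => r ^ (n - 1)) (𝓝[>] 0) (𝓝 (0 ^ (n - 1))) :=
      (continuousAt_rpow_const 0 (n - 1) (Or.inr (by linarith))).tendsto.mono_left
        nhdsWithin_le_nhds
    simpa using hpow.mul (h.tendsto_deriv_zero hn hα hp)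
  have hle := hanti.le_of_tendsto_nhdsGT_zero hlim hr
  exact nonpos_of_mul_nonpos_right hle (rpow_pos_of_pos hr.1 _)

lemma le_apply_zero (h : IsHenonSolution n α p u) (hn : 2 < n) (hα : 0 ≤ α) (hp : 1 < p)
    {r : ℝ} (hr : r ∈ Ioo (0 : ℝ) 1) : u r ≤ u 0 :=
  (antitoneOn_Ioo_of_hasDerivAt_nonpos (fun _ hs => h.hasDerivAt hs)
    fun _ hs => h.deriv_nonpos hn hα hp hs).le_of_tendsto_nhdsGT_zero h.tendsto_zero hr

lemma apply_zero_pos (h : IsHenonSolution n α p u) : 0 < u 0 := h.pos 0 (by simp)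

lemma henonScale_pos (h : IsHenonSolution n α p u) : 0 < henonScale α p u :=
  rpow_pos_of_pos h.apply_zero_pos _

lemma div_henonScale_mem (h : IsHenonSolution n α p u) {r : ℝ}
    (hr : r ∈ Ioo 0 (henonScale α p u)) : r / henonScale α p u ∈ Ioo (0 : ℝ) 1 :=
  ⟨div_pos hr.1 h.henonScale_pos, (div_lt_one h.henonScale_pos).2 hr.2⟩

lemma hasDerivAt_henonRescale (h : IsHenonSolution n α p u) {r : ℝ}
    (hr : r ∈ Ioo 0 (henonScale α p u)) :
    HasDerivAt (henonRescale α p u) (deriv (henonRescale α p u) r) r := by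
  have hd := ((h.hasDerivAt (h.div_henonScale_mem hr)).comp r
    ((hasDerivAt_id r).div_const (henonScale α p u))).div_const (u 0)
  exact hd.differentiableAt.hasDerivAt

lemma hasDerivAt_deriv_henonRescale (h : IsHenonSolution n α p u) (hα : 0 ≤ α) {r : ℝ}
    (hr : r ∈ Ioo 0 (henonScale α p u)) :
    HasDerivAt (deriv (henonRescale α p u))
      (-((n - 1) / r) * deriv (henonRescale α p u) r -
        r ^ α * henonRescale α p u r ^ p) r := by
  have hs := h.henonScale_pos
  have hu := h.apply_zero_pos
  have hmem := h.div_henonScale_mem hr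
  have hd := ((h.hasDerivAt_deriv hmem).comp r
    ((hasDerivAt_id r).div_const (henonScale α p u))).div_const (u 0 * henonScale α p u)
  have heq : deriv (henonRescale α p u) =
      fun s => deriv u (s / henonScale α p u) / (u 0 * henonScale α p u) :=
    funext (deriv_henonRescale α p u)
  rw [heq]
  refine hd.congr_deriv ?_
  have hscale : henonScale α p u ^ α * henonScale α p u ^ 2 * u 0 = u 0 ^ p := by
    rw [← rpow_two, ← rpow_add hs, henonScale, ← rpow_mul hu.le]
    have hexp : (p - 1) / (2 + α) * (α + 2) = p - 1 := by
      have : 2 + α ≠ 0 := by linarith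
      field_simp
      ring
    rw [hexp, rpow_sub_one hu.ne']
    field_simp
  rw [henonRescale, div_rpow hr.1.le hs.le,
    div_rpow (h.pos _ ⟨hmem.1.le, hmem.2⟩).le hu.le, ← hscale]
  have := rpow_pos_of_pos hs α
  have := hr.1
  field_simp

lemma tendsto_div_henonScale (h : IsHenonSolution n α p u) :
    Tendsto (fun r => r / henonScale α p u) (𝓝[>] 0) (𝓝[>] 0) := by
  refine tendsto_nhdsWithin_iff.2 ⟨?_, ?_⟩
  · have hid : Tendsto (fun r : ℝ => r) (𝓝[>] 0) (𝓝 0) := nhdsWithin_le_nhds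
    simpa using hid.div_const (henonScale α p u)
  · filter_upwards [self_mem_nhdsWithin] with r hr
    exact div_pos hr h.henonScale_pos

/-- The rescaled solution is close in `C¹` to the bubble, as far as both are defined, when `p`
is close to the critical exponent. -/
lemma dist_henonRescale_le (h : IsHenonSolution n α p u) (hn : 2 < n) (hα : 0 ≤ α) (hp : 1 < p)
    {q : ℝ} (hq : q = (n + 2 + 2 * α) / (n - 2)) (hpq : p ≤ q) {R r : ℝ}
    (hr : r ∈ Ioo 0 (min R (henonScale α p u))) :
    |henonRescale α p u r - henonBubble n α r| ≤
      √(R * exp ((2 + R ^ α * q) * R)) * R ^ α * (q - p) ∧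
    |deriv (henonRescale α p u) r - henonBubbleDeriv n α r| ≤
      √(R * exp ((2 + R ^ α * q) * R)) * R ^ α * (q - p) := by
  have hR : 0 < R := hr.1.trans (hr.2.trans_le (min_le_left _ _))
  have hRα : 0 < R ^ α := rpow_pos_of_pos hR α
  have hK : 0 ≤ R ^ α * q := mul_nonneg hRα.le (by linarith)
  have hmem : ∀ s ∈ Ioo 0 (min R (henonScale α p u)), s ∈ Ioo 0 (henonScale α p u) := fun s hs =>
    ⟨hs.1, hs.2.trans_le (min_le_right _ _)⟩
  have hw0 : Tendsto (fun s => henonRescale α p u s - henonBubble n α s) (𝓝[>] 0) (𝓝 0) := by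
    have h1 : Tendsto (henonRescale α p u) (𝓝[>] 0) (𝓝 (u 0 / u 0)) :=
      (h.tendsto_zero.comp h.tendsto_div_henonScale).div_const (u 0)
    have h2 : Tendsto (henonBubble n α) (𝓝[>] 0) (𝓝 (henonBubble n α 0)) :=
      (hasDerivAt_henonBubble hn hα le_rfl).continuousAt.tendsto.mono_left nhdsWithin_le_nhds
    rw [henonBubble_zero hα] at h2
    rw [div_self h.apply_zero_pos.ne'] at h1
    simpa using h1.sub h2
  have hw'0 : Tendsto (fun s => deriv (henonRescale α p u) s - henonBubbleDeriv n α s)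
      (𝓝[>] 0) (𝓝 0) := by
    have h1 : Tendsto (deriv (henonRescale α p u)) (𝓝[>] 0) (𝓝 0) := by
      have := ((h.tendsto_deriv_zero hn hα hp).comp h.tendsto_div_henonScale).div_const
        (u 0 * henonScale α p u)
      rw [zero_div] at this
      exact this.congr fun s => (deriv_henonRescale α p u s).symm
    simpa using h1.sub (tendsto_henonBubbleDeriv_zero (n := n) hα)
  have hE := energy_gronwall (T := min R (henonScale α p u)) (ε := R ^ α * (q - p)) hK
    (fun s hs => (h.hasDerivAt_henonRescale (hmem s hs)).sub
      (hasDerivAt_henonBubble hn hα hs.1.le))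
    (fun s hs => (h.hasDerivAt_deriv_henonRescale hα (hmem s hs)).sub
      (hasDerivAt_henonBubbleDeriv hn hα hs.1)) hw0 hw'0 ?_ hr
  · simp only [Pi.sub_apply] at hE
    have hbound : (R ^ α * (q - p)) ^ 2 * r * exp ((2 + R ^ α * q) * r) ≤
        (√(R * exp ((2 + R ^ α * q) * R)) * R ^ α * (q - p)) ^ 2 := by
      have hrR : r ≤ R := (hr.2.trans_le (min_le_left _ _)).le
      have hr0 := hr.1.le
      rw [mul_assoc √_, mul_pow √_, sq_sqrt (by positivity), mul_assoc, mul_comm (_ ^ 2)]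
      gcongr
    have hD : 0 ≤ √(R * exp ((2 + R ^ α * q) * R)) * R ^ α * (q - p) := by
      have := sub_nonneg.2 hpq
      positivity
    constructor <;> refine abs_le_of_sq_le_sq ?_ hD
    · nlinarith [sq_nonneg (deriv (henonRescale α p u) r - henonBubbleDeriv n α r)]
    · nlinarith [sq_nonneg (henonRescale α p u r - henonBubble n α r)]
  · intro s hs
    have hs0 := hs.1
    have hsR : s ≤ R := (hs.2.trans_le (min_le_left _ _)).le
    have hu := h.apply_zero_pos
    have hm := h.div_henonScale_mem (hmem s hs)
    have hx : henonRescale α p u s ∈ Icc (0 : ℝ) 1 :=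
      ⟨(div_pos (h.pos _ ⟨hm.1.le, hm.2⟩) hu).le, (div_le_one hu).2 (h.le_apply_zero hn hα hp hm)⟩
    have hlip := abs_rpow_sub_rpow_le hp.le hpq hx
      ⟨henonBubble_pos hn hα hs0.le, henonBubble_le_one hn hα hs0.le⟩
    rw [← hq]
    simp only [Pi.sub_apply]
    set x := henonRescale α p u s
    set y := henonBubble n α s
    set d := deriv (henonRescale α p u) s - henonBubbleDeriv n α s with hd
    have hsα : s ^ α ≤ R ^ α := rpow_le_rpow hs0.le hsR hα
    have hsα0 : 0 ≤ s ^ α := rpow_nonneg hs0.le α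
    have hn1 : 0 ≤ (n - 1) / s := div_nonneg (by linarith) hs0.le
    calc d * (-((n - 1) / s) * deriv (henonRescale α p u) s - s ^ α * x ^ p -
          (-((n - 1) / s) * henonBubbleDeriv n α s - s ^ α * y ^ q))
        = -((n - 1) / s * d ^ 2) + -(d * (s ^ α * (x ^ p - y ^ q))) := by rw [hd]; ring
      _ ≤ |d * (s ^ α * (x ^ p - y ^ q))| := by
          have := mul_nonneg hn1 (sq_nonneg d)
          linarith [neg_le_abs (d * (s ^ α * (x ^ p - y ^ q)))]
      _ = |d| * (s ^ α * |x ^ p - y ^ q|) := by rw [abs_mul, abs_mul, abs_of_nonneg hsα0]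
      _ ≤ |d| * (R ^ α * (q * |x - y| + (q - p))) := by gcongr
      _ = |d| * (R ^ α * q * |x - y| + R ^ α * (q - p)) := by ring

/-- If `p` is close to the critical exponent, the rescaled ball is large. -/
lemma lt_henonScale (h : IsHenonSolution n α p u) (hn : 2 < n) (hα : 0 ≤ α) (hp : 1 < p)
    {q : ℝ} (hq : q = (n + 2 + 2 * α) / (n - 2)) (hpq : p ≤ q) {R : ℝ} (hR : 0 < R)
    (hsmall : √(R * exp ((2 + R ^ α * q) * R)) * R ^ α * (q - p) < henonBubble n α R) :
    R < henonScale α p u := by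
  by_contra! hle
  set m := henonScale α p u with hm
  have hm0 : 0 < m := h.henonScale_pos
  have hdiv : Tendsto (fun r => r / m) (𝓝[<] m) (𝓝[Icc 0 1] 1) := by
    refine tendsto_nhdsWithin_iff.2 ⟨?_, ?_⟩
    · have : Tendsto (fun r => r / m) (𝓝 m) (𝓝 (m / m)) := tendsto_id.div_const m
      rw [div_self hm0.ne'] at this
      exact this.mono_left nhdsWithin_le_nhds
    · filter_upwards [Ioo_mem_nhdsLT hm0] with r hr
      exact ⟨(h.div_henonScale_mem hr).1.le, (h.div_henonScale_mem hr).2.le⟩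
  have hv : Tendsto (henonRescale α p u) (𝓝[<] m) (𝓝 0) := by
    have := ((h.contDiffOn.continuousOn 1 (by simp)).tendsto.comp hdiv).div_const (u 0)
    rw [h.apply_one, zero_div] at this
    exact this
  have hlim := hv.add_const (√(R * exp ((2 + R ^ α * q) * R)) * R ^ α * (q - p))
  rw [zero_add] at hlim
  refine hsmall.not_ge (ge_of_tendsto hlim ?_)
  filter_upwards [Ioo_mem_nhdsLT hm0] with r hr
  have hb := (h.dist_henonRescale_le hn hα hp hq hpq (R := R)
    ⟨hr.1, lt_min (hr.2.trans_le hle) hr.2⟩).1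
  have hmono := henonBubble_antitoneOn hn hα hr.1.le hR.le (hr.2.le.trans hle)
  linarith [neg_le_of_abs_le hb]

end IsHenonSolution

lemma deriv_henonBubble {n α r : ℝ} (hn : 2 < n) (hα : 0 ≤ α) (hr : 0 ≤ r) :
    deriv (henonBubble n α) r = henonBubbleDeriv n α r :=
  (hasDerivAt_henonBubble hn hα hr).deriv

/-- for a family of positive C² radial solutions `u_p` of the Hénon equation on
the unit ball (`u_p > 0` on `[0,1)`, `u_p(1) = 0`, `u_p'(0) = 0`) with `p ∈ (1, p_α)`, as
`p → p_α⁻` one has `μ_p = u_p(0) → +∞` and the rescalings `ũ_p(r) = u_p(r/μ̃_p)/μ_p`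
(with `μ̃_p = μ_p^{(p-1)/(2+α)}`) converge to `U_α` in `C¹_loc[0,∞)`: for every `R > 0`,
`ũ_p → U_α` and `ũ_p' → U_α'` uniformly on `[0,R]`. -/
theorem stmt18 (N : ℕ) (hN : 3 ≤ N) (α : ℝ) (hα : 0 ≤ α)
    (pα : ℝ) (hpα : pα = ((N : ℝ) + 2 + 2 * α) / ((N : ℝ) - 2))
    (u : ℝ → ℝ → ℝ)
    (hreg : ∀ p ∈ Set.Ioo 1 pα, ContDiffOn ℝ 2 (u p) (Set.Icc 0 1))
    (hpos : ∀ p ∈ Set.Ioo 1 pα, ∀ r ∈ Set.Ico (0 : ℝ) 1, 0 < u p r)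
    (hu1 : ∀ p ∈ Set.Ioo 1 pα, u p 1 = 0)
    (hd0 : ∀ p ∈ Set.Ioo 1 pα, deriv (u p) 0 = 0)
    (hode : ∀ p ∈ Set.Ioo 1 pα, ∀ r ∈ Set.Ioo (0 : ℝ) 1,
      deriv (deriv (u p)) r + (((N : ℝ) - 1) / r) * deriv (u p) r + r ^ α * u p r ^ p = 0) :
    Tendsto (fun p => u p 0) (𝓝[<] pα) atTop ∧
    ∀ R > (0 : ℝ),
      TendstoUniformlyOn
        (fun p r => u p (r / (u p 0) ^ ((p - 1) / (2 + α))) / u p 0)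
        (fun r => (1 + r ^ (2 + α) / (((N : ℝ) + α) * ((N : ℝ) - 2))) ^
          (-((N : ℝ) - 2) / (2 + α)))
        (𝓝[<] pα) (Set.Icc 0 R) ∧
      TendstoUniformlyOn
        (fun p r => deriv (fun y : ℝ => u p (y / (u p 0) ^ ((p - 1) / (2 + α))) / u p 0) r)
        (deriv (fun r : ℝ => (1 + r ^ (2 + α) / (((N : ℝ) + α) * ((N : ℝ) - 2))) ^
          (-((N : ℝ) - 2) / (2 + α))))
        (𝓝[<] pα) (Set.Icc 0 R) := by
  have hn : (2 : ℝ) < N := by exact_mod_cast hN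
  have hsol : ∀ p ∈ Ioo 1 pα, IsHenonSolution N α p (u p) := fun p hp =>
    ⟨hreg p hp, hpos p hp, hu1 p hp, hode p hp⟩
  have hp1 : 1 < pα := by
    rw [hpα, one_lt_div (by linarith)]
    linarith
  have hev : ∀ᶠ p in 𝓝[<] pα, p ∈ Ioo 1 pα := Ioo_mem_nhdsLT hp1
  have hsmall : ∀ R δ : ℝ, 0 < δ → ∀ᶠ p in 𝓝[<] pα,
      √(R * exp ((2 + R ^ α * pα) * R)) * R ^ α * (pα - p) < δ := fun R δ hδ => by
    have hlim : Tendsto (fun p => √(R * exp ((2 + R ^ α * pα) * R)) * R ^ α * (pα - p))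
        (𝓝[<] pα) (𝓝 (√(R * exp ((2 + R ^ α * pα) * R)) * R ^ α * (pα - pα))) :=
      (Continuous.tendsto (by fun_prop) pα).mono_left nhdsWithin_le_nhds
    rw [sub_self, mul_zero] at hlim
    exact hlim.eventually_lt_const hδ
  have hscale : ∀ R : ℝ, 0 < R → ∀ᶠ p in 𝓝[<] pα, R < henonScale α p (u p) := fun R hR => by
    filter_upwards [hev, hsmall R _ (henonBubble_pos hn hα hR.le)] with p hp hs
    exact (hsol p hp).lt_henonScale hn hα hp.1 hpα hp.2.le hR hs
  have hclose : ∀ R δ : ℝ, 0 < R → 0 < δ → ∀ᶠ p in 𝓝[<] pα, ∀ r ∈ Icc 0 R,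
      |henonRescale α p (u p) r - henonBubble N α r| < δ ∧
      |deriv (henonRescale α p (u p)) r - deriv (henonBubble N α) r| < δ := by
    intro R δ hR hδ
    filter_upwards [hev, hsmall (R + 1) δ hδ, hscale R hR] with p hp hs hm r hr
    have h := hsol p hp
    rw [deriv_henonBubble hn hα hr.1]
    rcases hr.1.eq_or_lt with rfl | hr0
    · rw [deriv_henonRescale, henonRescale, zero_div, div_self h.apply_zero_pos.ne', hd0 p hp,
        henonBubble_zero hα, henonBubbleDeriv_zero hα]
      simpa using hδ
    · have hb := h.dist_henonRescale_le hn hα hp.1 hpα hp.2.le (R := R + 1) (r := r)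
        ⟨hr0, lt_min (by linarith [hr.2]) (hr.2.trans_lt hm)⟩
      exact ⟨hb.1.trans_lt hs, hb.2.trans_lt hs⟩
  refine ⟨?_, fun R hR => ⟨?_, ?_⟩⟩
  · refine tendsto_atTop.2 fun A => ?_
    have hA : (1 : ℝ) ≤ max A 1 := le_max_right A 1
    filter_upwards [hev, hscale (max A 1 ^ ((pα - 1) / (2 + α))) (by positivity)] with p hp hm
    have h2 : 0 < 2 + α := by linarith
    have hle : max A 1 ^ ((p - 1) / (2 + α)) ≤ max A 1 ^ ((pα - 1) / (2 + α)) := by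
      refine rpow_le_rpow_of_exponent_le hA ?_
      gcongr
      exact hp.2.le
    have hlt := hle.trans_lt hm
    rw [henonScale, rpow_lt_rpow_iff (by positivity) (hsol p hp).apply_zero_pos.le
      (div_pos (by linarith [hp.1]) h2)] at hlt
    exact (le_max_left A 1).trans hlt.le
  · refine Metric.tendstoUniformlyOn_iff.2 fun δ hδ => ?_
    filter_upwards [hclose R δ hR hδ] with p hp r hr
    rw [dist_comm]
    exact (hp r hr).1
  · refine Metric.tendstoUniformlyOn_iff.2 fun δ hδ => ?_
    filter_upwards [hclose R δ hR hδ] with p hp r hr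
    rw [dist_comm]
    exact (hp r hr).2
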